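/- arXiv:1907.00171 — 2 statements merged into one kernel-verified Lean document; each statement's English description precedes it below -/
import Mathlib

section
/- Let H ∈ (0, 1/2). There exists a constant C > 0, depending only on H, such that for every measurable function φ : [0,1] → ℝ with ∫_0^1 φ(s)² ds < ∞ one has ∫_0^1 t^{1−2H} ( ∫_t^1 (s−t)^{−1/2−H} s^{H−1/2} |φ(s)| ds )² dt ≤ C ∫_0^1 φ(s)² ds. -/
open MeasureTheory

/-- Cauchy–Schwarz for a weighted lower integral. -/
lemma sq_lintegral_mul_le {β : Type*} [MeasurableSpace β] {ν : Measure β}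
    {k f : β → ENNReal} (hk : Measurable k) (hf : Measurable f) :
    (∫⁻ y, k y * f y ∂ν) ^ 2 ≤ (∫⁻ y, k y ∂ν) * ∫⁻ y, k y * f y ^ 2 ∂ν := by
  have h := ENNReal.lintegral_mul_le_Lp_mul_Lq ν Real.HolderConjugate.two_two
    (f := fun y => k y ^ (1 / 2 : ℝ)) (g := fun y => k y ^ (1 / 2 : ℝ) * f y)
    (hk.pow_const _).aemeasurable ((hk.pow_const _).mul hf).aemeasurable
  have hsq : ∀ x : ENNReal, (x ^ (1 / 2 : ℝ)) ^ 2 = x := fun x => by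
    rw [← ENNReal.rpow_natCast, ← ENNReal.rpow_mul]; norm_num
  simp only [Pi.mul_apply, ENNReal.rpow_two, ← mul_assoc, mul_pow, ← sq, hsq] at h
  calc _ ≤ _ := pow_le_pow_left' h 2
    _ = _ := by rw [mul_pow, hsq, hsq]

/-- **Schur test** with trivial weights for the exponent two. -/
lemma lintegral_sq_lintegral_mul_le {α β : Type*} [MeasurableSpace α] [MeasurableSpace β]
    {μ : Measure α} {ν : Measure β} [SFinite μ] [SFinite ν] {K : α → β → ENNReal}
    (hK : Measurable (Function.uncurry K)) {A B : ENNReal}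
    (hA : ∀ x, ∫⁻ y, K x y ∂ν ≤ A) (hB : ∀ y, ∫⁻ x, K x y ∂μ ≤ B)
    {f : β → ENNReal} (hf : Measurable f) :
    ∫⁻ x, (∫⁻ y, K x y * f y ∂ν) ^ 2 ∂μ ≤ A * B * ∫⁻ y, f y ^ 2 ∂ν := by
  have hKf : Measurable (Function.uncurry fun x y => K x y * f y ^ 2) :=
    hK.mul ((hf.comp measurable_snd).pow_const 2)
  calc ∫⁻ x, (∫⁻ y, K x y * f y ∂ν) ^ 2 ∂μ
      ≤ ∫⁻ x, A * ∫⁻ y, K x y * f y ^ 2 ∂ν ∂μ := lintegral_mono fun x =>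
        (sq_lintegral_mul_le hK.of_uncurry_left hf).trans (mul_le_mul_left (hA x) _)
    _ = A * ∫⁻ y, (∫⁻ x, K x y ∂μ) * f y ^ 2 ∂ν := by
        rw [lintegral_const_mul _ hKf.lintegral_prod_right,
          lintegral_lintegral_swap hKf.aemeasurable]
        congr 1
        exact lintegral_congr fun y => lintegral_mul_const _ hK.of_uncurry_right
    _ ≤ A * ∫⁻ y, B * f y ^ 2 ∂ν := by
        gcongr with y
        exact hB y
    _ = A * B * ∫⁻ y, f y ^ 2 ∂ν := by
        rw [lintegral_const_mul _ (hf.pow_const 2), mul_assoc]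

/-- The kernel `x ^ (a - 1)` is integrable on `(0, 1]` for `a > 0`. -/
lemma lintegral_Ioc_rpow_sub_one {a : ℝ} (ha : 0 < a) :
    ∫⁻ x in Set.Ioc (0 : ℝ) 1, ENNReal.ofReal (x ^ (a - 1)) = ENNReal.ofReal a⁻¹ := by
  have hint : IntervalIntegrable (fun x : ℝ => x ^ (a - 1)) volume 0 1 :=
    intervalIntegral.intervalIntegrable_rpow' (by linarith)
  rw [← ofReal_integral_eq_lintegral_ofReal
      ((intervalIntegrable_iff_integrableOn_Ioc_of_le zero_le_one).1 hint)
      (ae_restrict_of_forall_mem measurableSet_Ioc fun x hx => Real.rpow_nonneg hx.1.le _),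
    ← intervalIntegral.integral_of_le zero_le_one, integral_rpow (Or.inl (by linarith))]
  simp [ha.ne']

/-- Let `H ∈ (0, 1/2)`. There is a constant `C > 0`, depending only on `H`,
such that for every measurable `φ : [0,1] → ℝ` with `∫_0^1 φ(s)² ds < ∞` one has
`∫_0^1 t^(1-2H) (∫_t^1 (s-t)^(-1/2-H) s^(H-1/2) |φ(s)| ds)² dt ≤ C ∫_0^1 φ(s)² ds`. -/
theorem stmt1 (H : ℝ) (hH : H ∈ Set.Ioo (0 : ℝ) (1 / 2)) :
    ∃ C : ℝ, 0 < C ∧ ∀ φ : ℝ → ℝ, Measurable φ →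
      (∫⁻ s in Set.Ioc (0 : ℝ) 1, ENNReal.ofReal ((φ s) ^ 2)) < ⊤ →
      (∫⁻ t in Set.Ioc (0 : ℝ) 1,
          ENNReal.ofReal (t ^ (1 - 2 * H) *
            (∫ s in Set.Ioc t 1,
              (s - t) ^ (-(1 / 2 : ℝ) - H) * s ^ (H - 1 / 2) * |φ s|) ^ 2))
        ≤ ENNReal.ofReal C * ∫⁻ s in Set.Ioc (0 : ℝ) 1, ENNReal.ofReal ((φ s) ^ 2) := by
  obtain ⟨a, rfl⟩ : ∃ a, H = 1 / 2 - a := ⟨1 / 2 - H, by ring⟩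
  have ha : 0 < a := by linarith [hH.2]
  refine ⟨a⁻¹ * a⁻¹, by positivity, fun φ hφ _ => ?_⟩
  rw [show 1 - 2 * (1 / 2 - a) = a * 2 by ring, show -(1 / 2 : ℝ) - (1 / 2 - a) = a - 1 by ring,
    show 1 / 2 - a - 1 / 2 = -a by ring]
  have hsq : ∀ x : ℝ, ENNReal.ofReal (x ^ 2) = ‖x‖ₑ ^ 2 := fun x => by
    rw [← enorm_pow, Real.enorm_of_nonneg (sq_nonneg x)]
  let κ : ℝ → ENNReal := (Set.Ioc 0 1).indicator fun x => ENNReal.ofReal (x ^ (a - 1))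
  have hκ : Measurable κ :=
    (measurable_id.pow_const _).ennreal_ofReal.indicator measurableSet_Ioc
  have hκ_int : ∫⁻ x, κ x = ENNReal.ofReal a⁻¹ := by
    rw [lintegral_indicator measurableSet_Ioc, lintegral_Ioc_rpow_sub_one ha]
  calc _ ≤ ∫⁻ t in Set.Ioc (0 : ℝ) 1, (∫⁻ s in Set.Ioc (0 : ℝ) 1, κ (s - t) * ‖φ s‖ₑ) ^ 2 := by
        refine setLIntegral_mono' measurableSet_Ioc fun t ht => ?_
        rw [Real.rpow_mul ht.1.le, Real.rpow_two, ← mul_pow, hsq, ← integral_const_mul]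
        gcongr
        calc _ ≤ _ := enorm_integral_le_lintegral_enorm _
          _ ≤ ∫⁻ s in Set.Ioc t 1, κ (s - t) * ‖φ s‖ₑ := by
              refine setLIntegral_mono' measurableSet_Ioc fun s hs => ?_
              have hs0 : 0 < s := ht.1.trans hs.1
              have hκs : κ (s - t) = ‖(s - t) ^ (a - 1)‖ₑ := by
                rw [Real.enorm_of_nonneg (Real.rpow_nonneg (sub_nonneg.2 hs.1.le) _)]
                have hmem : s - t ∈ Set.Ioc (0 : ℝ) 1 := ⟨sub_pos.2 hs.1, by linarith [ht.1, hs.2]⟩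
                exact Set.indicator_of_mem hmem _
              have hle : t ^ a * s ^ (-a) ≤ 1 := by
                rw [Real.rpow_neg hs0.le, ← div_eq_mul_inv]
                exact div_le_one_of_le₀ (Real.rpow_le_rpow ht.1.le hs.1.le ha.le)
                  (Real.rpow_nonneg hs0.le _)
              rw [hκs, ← enorm_mul]
              refine enorm_le_iff_norm_le.2 ?_
              rw [show t ^ a * ((s - t) ^ (a - 1) * s ^ (-a) * |φ s|)
                = (t ^ a * s ^ (-a)) * ((s - t) ^ (a - 1) * |φ s|) by ring, norm_mul]
              have h0 : 0 ≤ t ^ a * s ^ (-a) :=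
                mul_nonneg (Real.rpow_nonneg ht.1.le _) (Real.rpow_nonneg hs0.le _)
              rw [Real.norm_of_nonneg h0, norm_mul, norm_mul, Real.norm_eq_abs |φ s|, abs_abs,
                Real.norm_eq_abs (φ s)]
              exact mul_le_of_le_one_left (by positivity) hle
          _ ≤ _ := lintegral_mono_set (Set.Ioc_subset_Ioc_left ht.1.le)
    _ ≤ ENNReal.ofReal a⁻¹ * ENNReal.ofReal a⁻¹ * ∫⁻ s in Set.Ioc (0 : ℝ) 1, ‖φ s‖ₑ ^ 2 := by
        refine lintegral_sq_lintegral_mul_le (K := fun t s => κ (s - t))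
          (hκ.comp (measurable_snd.sub measurable_fst)) (fun t => ?_) (fun s => ?_) hφ.enorm
        · rw [← hκ_int, ← lintegral_sub_right_eq_self κ t]
          exact setLIntegral_le_lintegral _ _
        · rw [← hκ_int, ← lintegral_sub_left_eq_self κ s]
          exact setLIntegral_le_lintegral _ _
    _ = _ := by
        simp only [hsq]
        rw [ENNReal.ofReal_mul (by positivity)]
end

section
/- Let H ∈ (1/2, 1), d ≥ 1, 0 < T₁ < T₂ and set c := T₁/T₂. Let h : [0,T₁] → ℝ^d be continuously differentiable with h(0) = 0 and define h̃ : [0,T₂] → ℝ^d by h̃(t) := h(ct). For a continuously differentiable path g on an interval [0,T], put I_g(u) := ∫_0^u (u−s)^{1/2−H} s^{1/2−H} g'(s) ds for u ∈ [0,T]. Then: (i) I_{h̃}(u) = c^{2H−1} I_h(cu) for all u ∈ [0,T₂]; (ii) for every t ∈ (0,T₂] such that I_h is differentiable at ct, the function I_{h̃} is differentiable at t and t^{H−1/2} I_{h̃}'(t) = c^{H+1/2} (ct)^{H−1/2} I_h'(ct); (iii) if I_h is differentiable at almost every point of (0,T₁] and t ↦ t^{H−1/2} I_h'(t) is square-integrable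 on (0,T₁], then ∫_0^{T₂} |t^{H−1/2} I_{h̃}'(t)|² dt = c^{2H} ∫_0^{T₁} |t^{H−1/2} I_h'(t)|² dt. -/
open MeasureTheory

/-- Scaling of the fractional kernel integral: replacing `f` by `c • f (c * ·)` rescales the
integral by `c ^ (2 * H - 1)`. -/
lemma integral_fractional_kernel_scale {E : Type*} [NormedAddCommGroup E] [NormedSpace ℝ E]
    (f : ℝ → E) {H c u : ℝ} (hc : 0 < c) (hu : 0 ≤ u) :
    (∫ s in (0 : ℝ)..u, (((u - s) ^ ((1 : ℝ) / 2 - H)) * s ^ ((1 : ℝ) / 2 - H)) • (c • f (c * s)))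
      = c ^ (2 * H - 1) •
        ∫ s in (0 : ℝ)..c * u,
          (((c * u - s) ^ ((1 : ℝ) / 2 - H)) * s ^ ((1 : ℝ) / 2 - H)) • f s := by
  have key : ∀ s ∈ Set.uIcc 0 u,
      (((u - s) ^ ((1 : ℝ) / 2 - H)) * s ^ ((1 : ℝ) / 2 - H)) • (c • f (c * s))
        = c ^ (2 * H) •
          ((((c * u - c * s) ^ ((1 : ℝ) / 2 - H)) * (c * s) ^ ((1 : ℝ) / 2 - H)) •
            f (c * s)) := by
    intro s hs
    rw [Set.uIcc_of_le hu] at hs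
    rw [← mul_sub, Real.mul_rpow hc.le (sub_nonneg.2 hs.2), Real.mul_rpow hc.le hs.1,
      smul_smul, smul_smul]
    congr 1
    have hpow : c ^ (2 * H) * c ^ ((1 : ℝ) / 2 - H) * c ^ ((1 : ℝ) / 2 - H) = c := by
      rw [← Real.rpow_add hc, ← Real.rpow_add hc]
      ring_nf
      exact Real.rpow_one c
    linear_combination (-(u - s) ^ ((1 : ℝ) / 2 - H) * s ^ ((1 : ℝ) / 2 - H)) * hpow
  rw [intervalIntegral.integral_congr key, intervalIntegral.integral_smul,
    intervalIntegral.integral_comp_mul_left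
      (fun x => (((c * u - x) ^ ((1 : ℝ) / 2 - H)) * x ^ ((1 : ℝ) / 2 - H)) • f x) hc.ne',
    smul_smul, mul_zero, Real.rpow_sub_one hc.ne', div_eq_mul_inv (c ^ (2 * H))]

/-- **scaling of the Cameron–Martin norm, Lemma 4.3, `H > 1/2`.**
Let `c = T₁/T₂`, let `h` be a `C¹` path on `[0,T₁]` with derivative `h'` and `h 0 = 0`, and
let `h̃ t = h (c t)` (so that `h̃` has derivative `c • h'(c·)`).  With
`I_g(u) = ∫_0^u (u-s)^(1/2-H) s^(1/2-H) g'(s) ds`, one has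
(i) `I_h̃(u) = c^(2H-1) I_h(cu)` on `[0,T₂]`;
(ii) if `I_h` is differentiable at `ct` then `I_h̃` is differentiable at `t` and
`t^(H-1/2) I_h̃'(t) = c^(H+1/2) (ct)^(H-1/2) I_h'(ct)`;
(iii) if `I_h` is differentiable a.e. on `(0,T₁]` and `t ↦ t^(H-1/2) I_h'(t)` is
square-integrable there, then
`∫_0^{T₂} |t^(H-1/2) I_h̃'(t)|² dt = c^(2H) ∫_0^{T₁} |t^(H-1/2) I_h'(t)|² dt`. -/
theorem stmt3 (H : ℝ) (hH : H ∈ Set.Ioo (1 / 2 : ℝ) 1) (d : ℕ) (hd : 1 ≤ d)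
    (T₁ T₂ : ℝ) (hT₁ : 0 < T₁) (hT₁₂ : T₁ < T₂)
    (c : ℝ) (hc : c = T₁ / T₂)
    (h h' : ℝ → EuclideanSpace ℝ (Fin d))
    (hderiv : ∀ s ∈ Set.Icc (0 : ℝ) T₁, HasDerivAt h (h' s) s)
    (hcont : ContinuousOn h' (Set.Icc (0 : ℝ) T₁))
    (h0 : h 0 = 0)
    (htilde : ℝ → EuclideanSpace ℝ (Fin d)) (hht : ∀ t, htilde t = h (c * t))
    (Ih Iht : ℝ → EuclideanSpace ℝ (Fin d))
    (hIh : ∀ u, Ih u =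
      ∫ s in (0 : ℝ)..u, (((u - s) ^ ((1 : ℝ) / 2 - H)) * s ^ ((1 : ℝ) / 2 - H)) • h' s)
    (hIht : ∀ u, Iht u =
      ∫ s in (0 : ℝ)..u, (((u - s) ^ ((1 : ℝ) / 2 - H)) * s ^ ((1 : ℝ) / 2 - H)) •
        (c • h' (c * s))) :
    (∀ u ∈ Set.Icc (0 : ℝ) T₂, Iht u = c ^ (2 * H - 1) • Ih (c * u)) ∧
    (∀ t ∈ Set.Ioc (0 : ℝ) T₂, DifferentiableAt ℝ Ih (c * t) →
      DifferentiableAt ℝ Iht t ∧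
      t ^ (H - 1 / 2) • deriv Iht t
        = (c ^ (H + 1 / 2) * (c * t) ^ (H - 1 / 2)) • deriv Ih (c * t)) ∧
    ((∀ᵐ t ∂(volume.restrict (Set.Ioc (0 : ℝ) T₁)), DifferentiableAt ℝ Ih t) →
      IntegrableOn (fun t => ‖t ^ (H - 1 / 2) • deriv Ih t‖ ^ 2) (Set.Ioc (0 : ℝ) T₁) →
      (∫ t in Set.Ioc (0 : ℝ) T₂, ‖t ^ (H - 1 / 2) • deriv Iht t‖ ^ 2)
        = c ^ (2 * H) * ∫ t in Set.Ioc (0 : ℝ) T₁, ‖t ^ (H - 1 / 2) • deriv Ih t‖ ^ 2) := by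
  have hT₂ : 0 < T₂ := hT₁.trans hT₁₂
  have hc0 : 0 < c := hc ▸ div_pos hT₁ hT₂
  have hcT : c * T₂ = T₁ := by rw [hc]; field_simp
  have scale : ∀ u, 0 ≤ u → Iht u = c ^ (2 * H - 1) • Ih (c * u) := fun u hu => by
    rw [hIht, hIh, integral_fractional_kernel_scale h' hc0 hu]
  have scale_nhds : ∀ t, 0 < t → Iht =ᶠ[nhds t] fun u => c ^ (2 * H - 1) • Ih (c * u) :=
    fun t ht => (eventually_gt_nhds ht).mono fun u hu => scale u (le_of_lt hu)
  have deriv_scale : ∀ t, 0 < t → t ^ (H - 1 / 2) • deriv Iht t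
      = (c ^ (H + 1 / 2) * (c * t) ^ (H - 1 / 2)) • deriv Ih (c * t) := fun t ht => by
    have hpow : c ^ (2 * H - 1) * c = c ^ (H + 1 / 2) * c ^ (H - 1 / 2) := by
      rw [← Real.rpow_add_one hc0.ne', ← Real.rpow_add hc0]
      ring_nf
    rw [(scale_nhds t ht).deriv_eq, deriv_fun_const_smul_field, deriv_comp_mul_left, smul_smul,
      smul_smul, Real.mul_rpow hc0.le ht.le]
    congr 1
    linear_combination t ^ (H - 1 / 2) * hpow
  refine ⟨fun u hu => scale u hu.1, fun t ht hd => ⟨?_, deriv_scale t ht.1⟩, fun _ _ => ?_⟩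
  · refine DifferentiableAt.congr_of_eventuallyEq ?_ (scale_nhds t ht.1)
    exact (hd.comp t (differentiableAt_id.const_mul c)).const_smul (c ^ (2 * H - 1))
  · have hsq : (c ^ (H + 1 / 2)) ^ 2 = c ^ (2 * H) * c := by
      rw [← Real.rpow_add_one hc0.ne', ← Real.rpow_natCast, ← Real.rpow_mul hc0.le]
      push_cast
      ring_nf
    have key : ∀ t ∈ Set.Ioc 0 T₂, ‖t ^ (H - 1 / 2) • deriv Iht t‖ ^ 2
        = (c ^ (2 * H) * c) * ‖(c * t) ^ (H - 1 / 2) • deriv Ih (c * t)‖ ^ 2 := fun t ht => by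
      rw [deriv_scale t ht.1, mul_smul, norm_smul, mul_pow, Real.norm_eq_abs, sq_abs, hsq]
    rw [setIntegral_congr_fun measurableSet_Ioc key, integral_const_mul,
      ← intervalIntegral.integral_of_le hT₂.le, ← intervalIntegral.integral_of_le hT₁.le,
      intervalIntegral.integral_comp_mul_left
        (fun x => ‖x ^ (H - 1 / 2) • deriv Ih x‖ ^ 2) hc0.ne', mul_zero, hcT, smul_eq_mul]
    field_simp
end
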